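/- arXiv:2106.09255 — 8 statements merged into one kernel-verified Lean document; each statement's English description precedes it below -/
import Mathlib

section
/- Let d ≥ 2 and M be positive integers, and let X be a real M × d² matrix such that every row of X has Euclidean norm at most 1, every entry of the first column of X equals 1/√d, and XᵀX is invertible. Then M · Tr((XᵀX)⁻¹) ≥ d⁴ + d³ − d². -/
open Matrix

/-- Tangent-line form of `(Gram⁻¹)ᵢᵢ ≥ 1 / Gramᵢᵢ`. -/
theorem two_mul_sub_sq_mul_le_inv_gram_diag {m n : Type*} [Fintype m] [Fintype n] [DecidableEq n]
    (X : Matrix m n ℝ) (hinv : IsUnit (Xᵀ * X)) (i : n) (t : ℝ) :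
    2 * t - t ^ 2 * (Xᵀ * X) i i ≤ (Xᵀ * X)⁻¹ i i := by
  have hdet : IsUnit (Xᵀ * X).det := (Matrix.isUnit_iff_isUnit_det _).1 hinv
  have hsymm : ((Xᵀ * X)⁻¹)ᵀ = (Xᵀ * X)⁻¹ := by
    rw [Matrix.transpose_nonsing_inv, Matrix.transpose_mul, Matrix.transpose_transpose]
  set Y := X * (Xᵀ * X)⁻¹ with hY
  have hXY : Xᵀ * Y = 1 := by
    rw [hY, ← Matrix.mul_assoc, Matrix.mul_nonsing_inv _ hdet]
  have hYY : Yᵀ * Y = (Xᵀ * X)⁻¹ := by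
    conv_lhs => rw [hY, Matrix.transpose_mul, hsymm, ← hY, Matrix.mul_assoc, hXY, Matrix.mul_one]
  have hone : ∑ k, X k i * Y k i = 1 := by
    simpa [Matrix.mul_apply] using congrFun (congrFun hXY i) i
  have hnonneg : 0 ≤ ∑ k, (Y k i - t * X k i) ^ 2 := Finset.sum_nonneg fun _ _ => sq_nonneg _
  have hexpand : ∑ k, (Y k i - t * X k i) ^ 2 =
      ∑ k, Y k i * Y k i - 2 * t * ∑ k, X k i * Y k i + t ^ 2 * ∑ k, X k i * X k i := by
    rw [Finset.mul_sum, Finset.mul_sum, ← Finset.sum_sub_distrib, ← Finset.sum_add_distrib]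
    exact Finset.sum_congr rfl fun _ _ => by ring
  rw [← hYY]
  simp only [Matrix.mul_apply, Matrix.transpose_apply]
  rw [hexpand, hone] at hnonneg
  linarith

/-- Minimum UMSE part of Theorem 1: for a probe-state parameterization matrix
`X ∈ ℝ^{M × d²}` whose rows have Euclidean norm at most 1, whose first column is
constantly `1/√d`, and with `XᵀX` invertible, we have
`M · Tr((XᵀX)⁻¹) ≥ d⁴ + d³ − d²`. -/
theorem stmt_0 (d M : ℕ) (hd : 2 ≤ d) (hM : 0 < M)
    (X : Matrix (Fin M) (Fin (d ^ 2)) ℝ)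
    (hrow : ∀ i : Fin M, ∑ j, (X i j) ^ 2 ≤ 1)
    (hcol : ∀ (i : Fin M) (j : Fin (d ^ 2)), (j : ℕ) = 0 → X i j = 1 / Real.sqrt d)
    (hinv : IsUnit (Xᵀ * X)) :
    (d : ℝ) ^ 4 + (d : ℝ) ^ 3 - (d : ℝ) ^ 2 ≤ (M : ℝ) * ((Xᵀ * X)⁻¹).trace := by
  have hdpos : (0 : ℝ) < d := by exact_mod_cast (by omega : 0 < d)
  have hMpos : (0 : ℝ) < M := by exact_mod_cast hM
  let z : Fin (d ^ 2) := ⟨0, by positivity⟩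
  have hz : (Xᵀ * X) z z = M / d := by
    simp only [Matrix.mul_apply, Matrix.transpose_apply, hcol _ z rfl, Finset.sum_const,
      Finset.card_univ, Fintype.card_fin, nsmul_eq_mul]
    rw [div_mul_div_comm, Real.mul_self_sqrt hdpos.le]
    ring
  have htrace : ∑ j, (Xᵀ * X) j j ≤ M := by
    simp only [Matrix.mul_apply, Matrix.transpose_apply]
    rw [Finset.sum_comm]
    calc ∑ i, ∑ j, X i j * X i j ≤ ∑ _i : Fin M, (1 : ℝ) :=
          Finset.sum_le_sum fun i _ => by simpa [sq] using hrow i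
      _ = M := by simp
  have hrest : ∑ j ∈ Finset.univ.erase z, (Xᵀ * X) j j ≤ M - M / d := by
    have h := Finset.add_sum_erase Finset.univ (fun j => (Xᵀ * X) j j) (Finset.mem_univ z)
    simp only [hz] at h
    linarith
  have hcard : ((Finset.univ.erase z).card : ℝ) = (d : ℝ) ^ 2 - 1 := by
    have h := Finset.card_erase_add_one (Finset.mem_univ z)
    rw [Finset.card_univ, Fintype.card_fin] at h
    have h' : ((Finset.univ.erase z).card : ℝ) + 1 = (d : ℝ) ^ 2 := by exact_mod_cast h
    linarith
  -- The reciprocal of the average of the remaining diagonal entries when all bounds are tight.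
  set s : ℝ := d * (d + 1) / M with hs
  have hsum : ((d : ℝ) ^ 2 - 1) * (2 * s) - s ^ 2 * (M - M / d) ≤
      ∑ j ∈ Finset.univ.erase z, (Xᵀ * X)⁻¹ j j := by
    have h := Finset.sum_le_sum fun j (_ : j ∈ Finset.univ.erase z) =>
      two_mul_sub_sq_mul_le_inv_gram_diag X hinv j s
    rw [Finset.sum_sub_distrib, Finset.sum_const, nsmul_eq_mul, hcard, ← Finset.mul_sum] at h
    linarith [mul_le_mul_of_nonneg_left hrest (sq_nonneg s)]
  have hfirst := two_mul_sub_sq_mul_le_inv_gram_diag X hinv z (d / M)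
  rw [hz] at hfirst
  have htot : ((Xᵀ * X)⁻¹).trace =
      (Xᵀ * X)⁻¹ z z + ∑ j ∈ Finset.univ.erase z, (Xᵀ * X)⁻¹ j j :=
    (Finset.add_sum_erase Finset.univ (fun j => (Xᵀ * X)⁻¹ j j) (Finset.mem_univ z)).symm
  calc (d : ℝ) ^ 4 + (d : ℝ) ^ 3 - (d : ℝ) ^ 2
      = M * ((2 * (d / M) - (d / M) ^ 2 * (M / d)) +
          (((d : ℝ) ^ 2 - 1) * (2 * s) - s ^ 2 * (M - M / d))) := by
        rw [hs]
        field_simp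
        ring
    _ ≤ M * ((Xᵀ * X)⁻¹).trace := by
        rw [htot]
        exact mul_le_mul_of_nonneg_left (add_le_add hfirst hsum) hMpos.le
end

section
/- Let d ≥ 2 and M be positive integers, and let X be a real M × d² matrix such that every row of X has Euclidean norm at most 1, every entry of the first column of X equals 1/√d, and XᵀX is invertible. Then cond(X) = σ_max(X)/σ_min(X) ≥ √(d+1). -/
open Matrix

/-- Diagonal entries of a real symmetric matrix are convex combinations of its eigenvalues. -/
lemma Matrix.IsHermitian.diag_eq_sum_sq_mul_eigenvalues {n : Type*} [Fintype n] [DecidableEq n]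
    {A : Matrix n n ℝ} (hA : A.IsHermitian) (j : n) :
    A j j = ∑ k, (hA.eigenvectorUnitary : Matrix n n ℝ) j k ^ 2 * hA.eigenvalues k := by
  conv_lhs => rw [hA.spectral_theorem]
  rw [Unitary.conjStarAlgAut_apply, Matrix.mul_apply]
  refine Finset.sum_congr rfl fun k _ => ?_
  rw [Matrix.mul_diagonal]
  simp [Matrix.star_apply]
  ring

/-- The rows of the matrix of eigenvectors have Euclidean norm one. -/
lemma Matrix.IsHermitian.sum_sq_eigenvectorUnitary {n : Type*} [Fintype n] [DecidableEq n]
    {A : Matrix n n ℝ} (hA : A.IsHermitian) (j : n) :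
    ∑ k, (hA.eigenvectorUnitary : Matrix n n ℝ) j k ^ 2 = 1 := by
  have h := congrFun (congrFun (Unitary.coe_mul_star_self hA.eigenvectorUnitary) j) j
  rw [Matrix.mul_apply, Matrix.one_apply_eq] at h
  rw [← h]
  refine Finset.sum_congr rfl fun k _ => ?_
  simp [Matrix.star_apply, sq]

lemma Matrix.IsHermitian.diag_le_iSup_eigenvalues {n : Type*} [Fintype n] [DecidableEq n]
    {A : Matrix n n ℝ} (hA : A.IsHermitian) (j : n) : A j j ≤ ⨆ i, hA.eigenvalues i := by
  rw [hA.diag_eq_sum_sq_mul_eigenvalues j, ← one_mul (⨆ i, hA.eigenvalues i),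
    ← hA.sum_sq_eigenvectorUnitary j, Finset.sum_mul]
  exact Finset.sum_le_sum fun k _ => mul_le_mul_of_nonneg_left
    (le_ciSup (Set.finite_range _).bddAbove k) (sq_nonneg _)

lemma Matrix.IsHermitian.iInf_eigenvalues_le_diag {n : Type*} [Fintype n] [DecidableEq n]
    {A : Matrix n n ℝ} (hA : A.IsHermitian) (j : n) : ⨅ i, hA.eigenvalues i ≤ A j j := by
  rw [hA.diag_eq_sum_sq_mul_eigenvalues j, ← one_mul (⨅ i, hA.eigenvalues i),
    ← hA.sum_sq_eigenvectorUnitary j, Finset.sum_mul]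
  exact Finset.sum_le_sum fun k _ => mul_le_mul_of_nonneg_left
    (ciInf_le (Set.finite_range _).bddBelow k) (sq_nonneg _)

/-- Minimum condition-number part of Theorem 1: for a probe-state parameterization
matrix `X ∈ ℝ^{M × d²}` whose rows have Euclidean norm at most 1, whose first column
is constantly `1/√d`, and with `XᵀX` invertible, the condition number
`cond(X) = σ_max(X)/σ_min(X) = √λ_max(XᵀX)/√λ_min(XᵀX)` is at least `√(d+1)`. -/
theorem stmt_1 (d M : ℕ) (hd : 2 ≤ d) (hM : 0 < M)
    (X : Matrix (Fin M) (Fin (d ^ 2)) ℝ)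
    (hrow : ∀ i : Fin M, ∑ j, (X i j) ^ 2 ≤ 1)
    (hcol : ∀ (i : Fin M) (j : Fin (d ^ 2)), (j : ℕ) = 0 → X i j = 1 / Real.sqrt d)
    (hinv : IsUnit (Xᵀ * X))
    (hH : (Xᵀ * X).IsHermitian) :
    Real.sqrt ((d : ℝ) + 1) ≤
      Real.sqrt (⨆ i, hH.eigenvalues i) / Real.sqrt (⨅ i, hH.eigenvalues i) := by
  have hd2 : 0 < d ^ 2 := by positivity
  have hdR : (2 : ℝ) ≤ d := by exact_mod_cast hd
  have : Nonempty (Fin (d ^ 2)) := ⟨⟨0, hd2⟩⟩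
  have hdiag : ∀ j, (Xᵀ * X) j j = ∑ i, X i j ^ 2 := fun j => by
    simp [Matrix.mul_apply, sq]
  have hpos : 0 < ⨅ i, hH.eigenvalues i := by
    have hsd : (Xᵀ * X).PosSemidef := by
      simpa [conjTranspose_eq_transpose_of_trivial] using
        Matrix.posSemidef_conjTranspose_mul_self X
    have hpd : (Xᵀ * X).PosDef := hsd.posDef_iff_isUnit.mpr hinv
    obtain ⟨i, hi⟩ := exists_eq_ciInf_of_finite (f := hH.eigenvalues)
    rw [← hi]
    exact hpd.eigenvalues_pos i
  set z : Fin (d ^ 2) := ⟨0, hd2⟩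
  have hz : (Xᵀ * X) z z = M / d := by
    rw [hdiag, Finset.sum_congr rfl fun i _ => by rw [hcol i z rfl]]
    simp [div_eq_mul_inv]
  have hmax := hH.diag_le_iSup_eigenvalues z
  have htrace : ∑ j, (Xᵀ * X) j j ≤ M := by
    simp_rw [hdiag]
    rw [Finset.sum_comm]
    exact (Finset.sum_le_sum fun i _ => hrow i).trans (by simp)
  have hmin : ((d : ℝ) ^ 2 - 1) * (⨅ i, hH.eigenvalues i) ≤
      ∑ j ∈ Finset.univ.erase z, (Xᵀ * X) j j := by
    refine le_trans (le_of_eq ?_) (Finset.card_nsmul_le_sum _ _ _ fun j _ =>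
      hH.iInf_eigenvalues_le_diag j)
    rw [Finset.card_erase_of_mem (Finset.mem_univ z), Finset.card_univ, Fintype.card_fin,
      nsmul_eq_mul, Nat.cast_sub hd2]
    simp
  rw [← Finset.add_sum_erase _ _ (Finset.mem_univ z), hz] at htrace
  rw [hz] at hmax
  generalize (⨆ i, hH.eigenvalues i) = b at *
  generalize (⨅ i, hH.eigenvalues i) = a at *
  rw [← Real.sqrt_div' _ hpos.le]
  refine Real.sqrt_le_sqrt ?_
  rw [le_div_iff₀ hpos]
  refine le_trans ?_ hmax
  have hM' : (M : ℝ) = d * (M / d) := by field_simp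
  have h : ((d : ℝ) - 1) * ((d + 1) * a) ≤ (d - 1) * (M / d) := by linarith
  exact le_of_mul_le_mul_left h (by linarith)
end

section
/- Let d ≥ 2 and M be positive integers, and let X be a real M × d² matrix such that every row of X has Euclidean norm at most 1, every entry of the first column of X equals 1/√d, and XᵀX is invertible. Then the equalities M · Tr((XᵀX)⁻¹) = d⁴ + d³ − d² and cond(X) = √(d+1) hold simultaneously if and only if XᵀX is the diagonal matrix diag(M/d, M/(d(d+1)), M/(d(d+1)), …, M/(d(d+1))), i.e. XᵀX has (1,1) entry M/d, all other diagonal entries M/(d(d+1)), and all off-diagonal entries zero. -/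
open Matrix

theorem sum_fin_ite_val_eq_zero {n : ℕ} (hn : 0 < n) (a b : ℝ) :
    ∑ j : Fin n, (if (j : ℕ) = 0 then a else b) = a + ((n : ℝ) - 1) * b := by
  obtain ⟨m, rfl⟩ : ∃ m, n = m + 1 := ⟨n - 1, by omega⟩
  simp [Fin.sum_univ_succ]

/-- The tangent-line inequality for `G ↦ Tr G⁻¹` at a diagonal matrix, in its equality case:
if the gap is nonpositive, the Gram matrix is the diagonal one. -/
theorem gram_inv_eq_diagonal_of_trace_le {m n : Type*} [Fintype m] [Fintype n] [DecidableEq n]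
    (X : Matrix m n ℝ) (hinv : IsUnit (Xᵀ * X)) (w : n → ℝ)
    (h : ((Xᵀ * X)⁻¹).trace + ∑ j, w j ^ 2 * ∑ i, X i j ^ 2 ≤ 2 * ∑ j, w j) :
    (Xᵀ * X)⁻¹ = diagonal w := by
  set G := Xᵀ * X with hG
  have hdet : IsUnit G.det := (Matrix.isUnit_iff_isUnit_det G).1 hinv
  have hGt : Gᵀ = G := by simp [hG]
  have hGit : (G⁻¹)ᵀ = G⁻¹ := by rw [Matrix.transpose_nonsing_inv, hGt]
  set E := diagonal w - G⁻¹ with hE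
  have hEt : Eᵀ = E := by simp [hE, hGit]
  have hexp : E * G * E = diagonal w * G * diagonal w - diagonal w - diagonal w + G⁻¹ := by
    have h1 : G⁻¹ * G = 1 := Matrix.nonsing_inv_mul G hdet
    have h2 : G * G⁻¹ = 1 := Matrix.mul_nonsing_inv G hdet
    simp only [hE, sub_mul, mul_sub, h1, one_mul]
    rw [Matrix.mul_assoc (diagonal w) G G⁻¹, h2, mul_one]
    abel
  have hDGD : (diagonal w * G * diagonal w).trace = ∑ j, w j ^ 2 * ∑ i, X i j ^ 2 := by
    simp only [trace, diag_apply, mul_diagonal, diagonal_mul]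
    refine Finset.sum_congr rfl fun j _ => ?_
    have : G j j = ∑ i, X i j ^ 2 := by
      simp [hG, Matrix.mul_apply, sq]
    rw [this]
    ring
  have htr : (E * G * E).trace ≤ 0 := by
    rw [hexp, trace_add, trace_sub, trace_sub, hDGD, trace_diagonal]
    linarith
  have hform : (X * E)ᴴ * (X * E) = E * G * E := by
    rw [conjTranspose_eq_transpose_of_trivial, transpose_mul, hEt, hG]
    simp only [Matrix.mul_assoc]
  have hXE : X * E = 0 := by
    rw [← Matrix.trace_conjTranspose_mul_self_eq_zero_iff, hform]
    refine le_antisymm htr ?_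
    rw [← hform]
    exact (Matrix.posSemidef_conjTranspose_mul_self _).trace_nonneg
  have hGE : G * E = 0 := by rw [hG, Matrix.mul_assoc, hXE, Matrix.mul_zero]
  have hE0 : E = 0 := hinv.mul_right_eq_zero.1 hGE
  exact (sub_eq_zero.1 hE0).symm

theorem inv_diagonal_of_ne_zero {n : Type*} [Fintype n] [DecidableEq n] (v : n → ℝ)
    (hv : ∀ j, v j ≠ 0) : (diagonal v)⁻¹ = diagonal (fun j => (v j)⁻¹) := by
  refine Matrix.inv_eq_right_inv ?_
  rw [diagonal_mul_diagonal, ← diagonal_one]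
  congr 1
  ext j
  exact mul_inv_cancel₀ (hv j)

theorem range_eigenvalues_of_eq_diagonal {n : Type*} [Fintype n] [DecidableEq n]
    {A : Matrix n n ℝ} (hA : A.IsHermitian) {v : n → ℝ} (h : A = diagonal v) :
    Set.range hA.eigenvalues = Set.range v := by
  rw [← hA.spectrum_real_eq_range_eigenvalues, h, spectrum_diagonal]

theorem range_fin_ite_val_eq_zero {n : ℕ} (hn : 2 ≤ n) (a b : ℝ) :
    Set.range (fun j : Fin n => if (j : ℕ) = 0 then a else b) = {a, b} := by
  ext x
  constructor
  · rintro ⟨j, rfl⟩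
    by_cases hj : (j : ℕ) = 0 <;> simp [hj]
  · rintro (rfl | rfl)
    · exact ⟨⟨0, by omega⟩, by simp⟩
    · exact ⟨⟨1, by omega⟩, by simp⟩

/-- Equality characterization of Theorem 1: the two minima
`M · Tr((XᵀX)⁻¹) = d⁴ + d³ − d²` and `cond(X) = √(d+1)` hold simultaneously
if and only if `XᵀX = diag(M/d, M/(d(d+1)), …, M/(d(d+1)))`. -/
theorem stmt_2 (d M : ℕ) (hd : 2 ≤ d) (hM : 0 < M)
    (X : Matrix (Fin M) (Fin (d ^ 2)) ℝ)
    (hrow : ∀ i : Fin M, ∑ j, (X i j) ^ 2 ≤ 1)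
    (hcol : ∀ (i : Fin M) (j : Fin (d ^ 2)), (j : ℕ) = 0 → X i j = 1 / Real.sqrt d)
    (hinv : IsUnit (Xᵀ * X))
    (hH : (Xᵀ * X).IsHermitian) :
    ((M : ℝ) * ((Xᵀ * X)⁻¹).trace = (d : ℝ) ^ 4 + (d : ℝ) ^ 3 - (d : ℝ) ^ 2 ∧
      Real.sqrt (⨆ i, hH.eigenvalues i) / Real.sqrt (⨅ i, hH.eigenvalues i) =
        Real.sqrt ((d : ℝ) + 1)) ↔
    Xᵀ * X = Matrix.diagonal (fun j : Fin (d ^ 2) =>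
      if (j : ℕ) = 0 then (M : ℝ) / d else (M : ℝ) / (d * (d + 1))) := by
  have hd0 : (0 : ℝ) < d := by positivity
  have hM0 : (0 : ℝ) < M := by positivity
  have hn : 2 ≤ d ^ 2 := by nlinarith
  set v : Fin (d ^ 2) → ℝ := fun j =>
    if (j : ℕ) = 0 then (M : ℝ) / d else (M : ℝ) / (d * (d + 1)) with hv
  have hv0 : ∀ j, v j ≠ 0 := by
    intro j
    simp only [hv]
    split_ifs <;> positivity
  have hw : ∀ j, (v j)⁻¹ = if (j : ℕ) = 0 then (d : ℝ) / M else d * (d + 1) / M := by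
    intro j
    simp only [hv]
    split_ifs <;> simp
  have hsum : ∑ j, (v j)⁻¹ = ((d : ℝ) ^ 4 + (d : ℝ) ^ 3 - (d : ℝ) ^ 2) / M := by
    simp only [hw]
    rw [sum_fin_ite_val_eq_zero (by omega)]
    push_cast
    field_simp
    ring
  constructor
  · rintro ⟨htr, -⟩
    have htr' : ((Xᵀ * X)⁻¹).trace = ∑ j, (v j)⁻¹ := by
      rw [hsum, ← htr]
      field_simp
    have hrow' : ∀ i, ∑ j, (v j)⁻¹ ^ 2 * X i j ^ 2 ≤ (∑ j, (v j)⁻¹) / M := by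
      intro i
      have hterm : ∀ j, (v j)⁻¹ ^ 2 * X i j ^ 2 = ((d : ℝ) * (d + 1) / M) ^ 2 * X i j ^ 2 +
          if (j : ℕ) = 0 then (((d : ℝ) / M) ^ 2 - ((d : ℝ) * (d + 1) / M) ^ 2) / d else 0 := by
        intro j
        rw [hw]
        split_ifs with hj
        · rw [hcol i j hj, div_pow 1, Real.sq_sqrt hd0.le]
          ring
        · ring
      simp only [hterm]
      rw [Finset.sum_add_distrib, ← Finset.mul_sum, sum_fin_ite_val_eq_zero (by omega), hsum]
      calc _ ≤ ((d : ℝ) * (d + 1) / M) ^ 2 * 1 +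
            ((((d : ℝ) / M) ^ 2 - ((d : ℝ) * (d + 1) / M) ^ 2) / d +
              (((d ^ 2 : ℕ) : ℝ) - 1) * 0) := by
            gcongr
            exact hrow i
        _ = _ := by
            field_simp
            ring
    have hbound : ∑ j, (v j)⁻¹ ^ 2 * ∑ i, X i j ^ 2 ≤ ∑ j, (v j)⁻¹ := by
      simp only [Finset.mul_sum]
      rw [Finset.sum_comm]
      refine (Finset.sum_le_sum fun i _ => hrow' i).trans_eq ?_
      simp only [Finset.sum_const, Finset.card_univ, Fintype.card_fin, nsmul_eq_mul]
      field_simp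
    have hGinv := gram_inv_eq_diagonal_of_trace_le X hinv (fun j => (v j)⁻¹)
      (by rw [htr']; linarith)
    rw [← inv_diagonal_of_ne_zero v hv0] at hGinv
    refine Matrix.inv_inj hGinv ?_
    exact (Matrix.isUnit_iff_isUnit_det _).1 hinv
  · intro h
    refine ⟨?_, ?_⟩
    · rw [h, inv_diagonal_of_ne_zero v hv0, trace_diagonal, hsum]
      field_simp
    · have hle : (M : ℝ) / (d * (d + 1)) ≤ M / d := by
        gcongr
        nlinarith
      rw [iSup, iInf, range_eigenvalues_of_eq_diagonal hH h, hv, range_fin_ite_val_eq_zero hn,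
        csSup_pair, csInf_pair, sup_eq_left.2 hle, inf_eq_right.2 hle,
        ← Real.sqrt_div (by positivity)]
      congr 1
      field_simp
end

section
/- Let d ≥ 1 be an integer, M > 0 a real number, and λ_1 ≥ λ_2 ≥ ⋯ ≥ λ_{d²} > 0 real numbers satisfying Σ_{i=1}^{d²} λ_i ≤ M and λ_1 ≥ M/d. Then Σ_{i=1}^{d²} M/λ_i ≥ d⁴ + d³ − d², with equality if and only if λ_1 = M/d and λ_2 = λ_3 = ⋯ = λ_{d²} = M/(d(d+1)). -/
/-- Tangent-line bound for the sum of reciprocals at a point `c`, with its equality case. -/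
theorem sum_inv_le_sum_inv_of_tangent {ι : Type*} [Fintype ι] {c x : ι → ℝ}
    (hc : ∀ i, 0 < c i) (hx : ∀ i, 0 < x i) (h : 0 ≤ ∑ i, (c i - x i) / c i ^ 2) :
    ∑ i, (c i)⁻¹ ≤ ∑ i, (x i)⁻¹ ∧
      (∑ i, (x i)⁻¹ = ∑ i, (c i)⁻¹ ↔ ∀ i, x i = c i) := by
  have key : ∑ i, (x i)⁻¹ = ∑ i, (c i)⁻¹ + ∑ i, (c i - x i) / c i ^ 2 +
      ∑ i, (x i - c i) ^ 2 / (x i * c i ^ 2) := by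
    rw [← Finset.sum_add_distrib, ← Finset.sum_add_distrib]
    refine Finset.sum_congr rfl fun i _ => ?_
    have := (hc i).ne'
    have := (hx i).ne'
    field_simp
    ring
  have hterm : ∀ i ∈ Finset.univ, 0 ≤ (x i - c i) ^ 2 / (x i * c i ^ 2) := fun i _ => by
    have := hc i
    have := hx i
    positivity
  have hrem := Finset.sum_nonneg hterm
  refine ⟨by linarith, fun heq i => ?_, fun heq => by simp [heq]⟩
  have hzero := (Finset.sum_eq_zero_iff_of_nonneg hterm).1 (by linarith) i (Finset.mem_univ i)
  have hden : x i * c i ^ 2 ≠ 0 := (mul_pos (hx i) (pow_pos (hc i) 2)).ne'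
  have hsq := (div_eq_zero_iff.1 hzero).resolve_right hden
  exact sub_eq_zero.1 (pow_eq_zero_iff two_ne_zero |>.1 hsq)

/-- The sum of a function taking one value at a distinguished point and another elsewhere. -/
theorem sum_ite_eq_add_card_sub_one_mul {ι : Type*} [Fintype ι] [DecidableEq ι]
    (i₀ : ι) (a b : ℝ) :
    ∑ i, (if i = i₀ then a else b) = a + ((Fintype.card ι : ℝ) - 1) * b := by
  have h : ∀ i, (if i = i₀ then a else b) = b + if i = i₀ then a - b else 0 := fun i => by
    split_ifs <;> ring
  simp only [h, Finset.sum_add_distrib, Finset.sum_ite_eq', Finset.mem_univ, if_true,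
    Finset.sum_const, Finset.card_univ, nsmul_eq_mul]
  ring

/-- Minimum of a sum of reciprocals under a budget constraint and a lower bound `a` on one
coordinate, where `a` is at least the common value `b` of the others at the optimum. -/
theorem sum_inv_ge_of_sum_le_of_le {ι : Type*} [Fintype ι] [DecidableEq ι] (i₀ : ι)
    {a b : ℝ} (hb : 0 < b) (hba : b ≤ a) {x : ι → ℝ} (hx : ∀ i, 0 < x i)
    (hsum : ∑ i, x i ≤ a + ((Fintype.card ι : ℝ) - 1) * b) (hx₀ : a ≤ x i₀) :
    a⁻¹ + ((Fintype.card ι : ℝ) - 1) * b⁻¹ ≤ ∑ i, (x i)⁻¹ ∧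
      (∑ i, (x i)⁻¹ = a⁻¹ + ((Fintype.card ι : ℝ) - 1) * b⁻¹ ↔
        ∀ i, x i = if i = i₀ then a else b) := by
  have ha : 0 < a := hb.trans_le hba
  have hinv : ∑ i, (if i = i₀ then a else b)⁻¹ = a⁻¹ + ((Fintype.card ι : ℝ) - 1) * b⁻¹ := by
    rw [← sum_ite_eq_add_card_sub_one_mul i₀]
    exact Finset.sum_congr rfl fun i _ => by split_ifs <;> rfl
  rw [← hinv]
  refine sum_inv_le_sum_inv_of_tangent (fun i => by split_ifs <;> assumption) hx ?_
  have hsplit : ∀ i, ((if i = i₀ then a else b) - x i) / (if i = i₀ then a else b) ^ 2 =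
      ((if i = i₀ then a else b) - x i) / b ^ 2 +
        if i = i₀ then (x i₀ - a) * (1 / b ^ 2 - 1 / a ^ 2) else 0 := fun i => by
    split_ifs with h
    · subst h
      ring
    · ring
  simp only [hsplit, Finset.sum_add_distrib, ← Finset.sum_div, Finset.sum_sub_distrib,
    sum_ite_eq_add_card_sub_one_mul, Finset.sum_ite_eq', Finset.mem_univ, if_true]
  have hslope : 1 / a ^ 2 ≤ 1 / b ^ 2 := by gcongr
  exact add_nonneg (div_nonneg (sub_nonneg.2 hsum) (by positivity))
    (mul_nonneg (sub_nonneg.2 hx₀) (sub_nonneg.2 hslope))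

/-- The constrained optimization in the proof of Theorem 1: if
`λ_1 ≥ ⋯ ≥ λ_{d²} > 0`, `Σ λ_i ≤ M` and `λ_1 ≥ M/d`, then
`Σ M/λ_i ≥ d⁴ + d³ − d²`, with equality iff `λ_1 = M/d` and all the other
`λ_i = M/(d(d+1))`. -/
theorem stmt_3 (d : ℕ) (hd : 1 ≤ d) (M : ℝ) (hM : 0 < M)
    (lam : Fin (d ^ 2) → ℝ) (hmono : Antitone lam) (hpos : ∀ i, 0 < lam i)
    (hsum : ∑ i, lam i ≤ M)
    (hfirst : ∀ i : Fin (d ^ 2), (i : ℕ) = 0 → M / d ≤ lam i) :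
    (d : ℝ) ^ 4 + (d : ℝ) ^ 3 - (d : ℝ) ^ 2 ≤ ∑ i, M / lam i ∧
    (∑ i, M / lam i = (d : ℝ) ^ 4 + (d : ℝ) ^ 3 - (d : ℝ) ^ 2 ↔
      ∀ i : Fin (d ^ 2),
        lam i = if (i : ℕ) = 0 then M / d else M / (d * (d + 1))) := by
  have hd' : (1 : ℝ) ≤ d := by exact_mod_cast hd
  have hd₀ : (0 : ℝ) < d := by linarith
  let i₀ : Fin (d ^ 2) := ⟨0, by positivity⟩
  have hi₀ : ∀ i : Fin (d ^ 2), (i : ℕ) = 0 ↔ i = i₀ := fun i => by simp [i₀, Fin.ext_iff]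
  have hba : M / (d * (d + 1)) ≤ M / d := by
    gcongr
    nlinarith
  have hbudget : ∑ i, lam i ≤
      M / d + ((Fintype.card (Fin (d ^ 2)) : ℝ) - 1) * (M / (d * (d + 1))) := by
    refine hsum.trans_eq ?_
    simp only [Fintype.card_fin, Nat.cast_pow]
    field_simp
    ring
  have hvalue : (d : ℝ) ^ 4 + (d : ℝ) ^ 3 - (d : ℝ) ^ 2 =
      M * ((M / d)⁻¹ + ((Fintype.card (Fin (d ^ 2)) : ℝ) - 1) * (M / (d * (d + 1)))⁻¹) := by
    simp only [Fintype.card_fin, Nat.cast_pow]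
    field_simp
    ring
  obtain ⟨hle, heq⟩ := sum_inv_ge_of_sum_le_of_le i₀ (by positivity) hba hpos hbudget
    (hfirst i₀ rfl)
  simp only [hi₀, div_eq_mul_inv M (lam _), ← Finset.mul_sum, hvalue]
  exact ⟨mul_le_mul_of_nonneg_left hle hM.le, (mul_right_inj' hM.ne').trans heq⟩
end

section
/- Let m ≥ 1 and let M_1, …, M_m be positive integers. For each i, let X_i be a real M_i × 4 matrix such that every row of X_i has Euclidean norm at most 1, every entry of the first column of X_i equals 1/√2, and X_iᵀX_i is invertible. Let X = X_1 ⊗ X_2 ⊗ ⋯ ⊗ X_m be their Kronecker product. Then (∏_{i=1}^m M_i) · Tr((XᵀX)⁻¹) ≥ 20^m and cond(X) ≥ 3^{m/2}, and equality holds simultaneously in both if and only if for every i, X_iᵀX_i = diag(M_i/2, M_i/6, M_i/6, M_i/6). -/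
open Matrix

namespace Matrix

section PiKronecker

variable {ι R : Type*} [Fintype ι] [CommRing R] {l m n : ι → Type*}

/-- The Kronecker product of a finite family of matrices. -/
def piKronecker (A : ∀ i, Matrix (m i) (n i) R) : Matrix (∀ i, m i) (∀ i, n i) R :=
  of fun f g => ∏ i, A i (f i) (g i)

theorem piKronecker_apply (A : ∀ i, Matrix (m i) (n i) R) (f : ∀ i, m i) (g : ∀ i, n i) :
    piKronecker A f g = ∏ i, A i (f i) (g i) := rfl

theorem piKronecker_mul [DecidableEq ι] [∀ i, Fintype (m i)]
    (A : ∀ i, Matrix (l i) (m i) R) (B : ∀ i, Matrix (m i) (n i) R) :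
    piKronecker A * piKronecker B = piKronecker fun i => A i * B i := by
  ext f g
  simp only [mul_apply, piKronecker_apply, ← Finset.prod_mul_distrib, Finset.prod_univ_sum,
    Fintype.piFinset_univ]

theorem piKronecker_diagonal [∀ i, DecidableEq (n i)] [DecidableEq (∀ i, n i)]
    (d : ∀ i, n i → R) :
    piKronecker (fun i => diagonal (d i)) = diagonal fun f => ∏ i, d i (f i) := by
  ext f g
  rw [piKronecker_apply]
  by_cases h : f = g
  · subst h
    simp
  · obtain ⟨i, hi⟩ := Function.ne_iff.mp h
    rw [diagonal_apply_ne _ h]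
    exact Finset.prod_eq_zero (Finset.mem_univ i) (diagonal_apply_ne _ hi)

theorem trace_piKronecker [DecidableEq ι] [∀ i, Fintype (n i)]
    (A : ∀ i, Matrix (n i) (n i) R) : (piKronecker A).trace = ∏ i, (A i).trace := by
  simp only [trace, diag_apply, piKronecker_apply, Finset.prod_univ_sum, Fintype.piFinset_univ]

theorem piKronecker_mul_piKronecker_inv [DecidableEq ι] [∀ i, Fintype (n i)]
    [∀ i, DecidableEq (n i)] [DecidableEq (∀ i, n i)]
    {A : ∀ i, Matrix (n i) (n i) R} (hA : ∀ i, IsUnit (A i)) :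
    piKronecker A * piKronecker (fun i => (A i)⁻¹) = 1 := by
  have h (i) : A i * (A i)⁻¹ = diagonal fun _ => 1 := by
    rw [mul_nonsing_inv _ ((isUnit_iff_isUnit_det _).mp (hA i)), diagonal_one]
  simp_rw [piKronecker_mul, h, piKronecker_diagonal]
  simp

end PiKronecker

section Hermitian

variable {n : Type*} [Fintype n] [DecidableEq n] {A : Matrix n n ℝ} (hA : A.IsHermitian)

theorem IsHermitian.apply_self_eq_sum_eigenvalues (i : n) :
    A i i = ∑ e, hA.eigenvalues e * (hA.eigenvectorUnitary : Matrix n n ℝ) i e ^ 2 := by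
  conv_lhs => rw [hA.spectral_theorem, Unitary.conjStarAlgAut_apply]
  rw [mul_apply]
  refine Finset.sum_congr rfl fun e _ => ?_
  rw [mul_diagonal, star_apply]
  simp only [Function.comp_apply, RCLike.ofReal_real_eq_id, id_eq, star_trivial]
  ring

theorem IsHermitian.sum_eigenvectorUnitary_sq (i : n) :
    ∑ e, (hA.eigenvectorUnitary : Matrix n n ℝ) i e ^ 2 = 1 := by
  have h := congr_fun₂ (Unitary.coe_mul_star_self hA.eigenvectorUnitary) i i
  rw [mul_apply, one_apply_eq] at h
  rw [← h]
  refine Finset.sum_congr rfl fun e _ => ?_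
  exact sq _

theorem IsHermitian.apply_self_le_iSup_eigenvalues (i : n) : A i i ≤ ⨆ e, hA.eigenvalues e := by
  rw [hA.apply_self_eq_sum_eigenvalues, ← mul_one (⨆ e, hA.eigenvalues e),
    ← hA.sum_eigenvectorUnitary_sq i, Finset.mul_sum]
  gcongr with e
  exact le_ciSup (Set.finite_range hA.eigenvalues).bddAbove e

theorem IsHermitian.iInf_eigenvalues_le_apply_self (i : n) : ⨅ e, hA.eigenvalues e ≤ A i i := by
  rw [hA.apply_self_eq_sum_eigenvalues, ← mul_one (⨅ e, hA.eigenvalues e),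
    ← hA.sum_eigenvectorUnitary_sq i, Finset.mul_sum]
  gcongr with e
  exact ciInf_le (Set.finite_range hA.eigenvalues).bddBelow e

theorem PosDef.iInf_eigenvalues_pos [Nonempty n] (hpos : A.PosDef) :
    0 < ⨅ e, hA.eigenvalues e := by
  obtain ⟨e, he⟩ := exists_eq_ciInf_of_finite (f := hA.eigenvalues)
  rw [← he]
  exact hpos.eigenvalues_pos e

theorem exists_eigenvalues_eq_of_eq_diagonal {d : n → ℝ} (hd : A = diagonal d) (e : n) :
    ∃ i, d i = hA.eigenvalues e := by
  have h : spectrum ℝ A = Set.range d := by rw [hd, spectrum_diagonal]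
  exact h.subset (hA.eigenvalues_mem_spectrum_real e)

end Hermitian

section GramMatrix

variable {m n : Type*} [Fintype m] [Fintype n] [DecidableEq n]

theorem posDef_transpose_mul_self_of_isUnit {X : Matrix m n ℝ} (h : IsUnit (Xᵀ * X)) :
    (Xᵀ * X).PosDef := by
  rw [← conjTranspose_eq_transpose_of_trivial] at h ⊢
  exact (posSemidef_conjTranspose_mul_self X).posDef_iff_isUnit.mpr h

theorem trace_transpose_mul_self_residual {X : Matrix m n ℝ} (h : IsUnit (Xᵀ * X))
    {D : Matrix n n ℝ} (hD : Dᵀ = D) :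
    ((X * ((Xᵀ * X)⁻¹ - D))ᵀ * (X * ((Xᵀ * X)⁻¹ - D))).trace =
      (Xᵀ * X)⁻¹.trace - 2 * D.trace + (Xᵀ * X * (D * D)).trace := by
  have hdet := (isUnit_iff_isUnit_det _).mp h
  have hsymm : ((Xᵀ * X)⁻¹)ᵀ = (Xᵀ * X)⁻¹ := by
    rw [transpose_nonsing_inv, transpose_mul, transpose_transpose]
  have : (X * ((Xᵀ * X)⁻¹ - D))ᵀ * (X * ((Xᵀ * X)⁻¹ - D)) =
      (Xᵀ * X)⁻¹ - D - D + D * (Xᵀ * X) * D := by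
    rw [transpose_mul, transpose_sub, hsymm, hD, Matrix.mul_assoc, ← Matrix.mul_assoc Xᵀ,
      ← Matrix.mul_assoc]
    rw [Matrix.sub_mul, nonsing_inv_mul _ hdet, Matrix.mul_sub, Matrix.sub_mul, Matrix.sub_mul,
      Matrix.mul_assoc D, mul_nonsing_inv _ hdet]
    simp only [Matrix.one_mul, Matrix.mul_one, Matrix.mul_assoc]
    abel
  rw [this, trace_add, trace_sub, trace_sub, trace_mul_cycle, Matrix.trace_mul_comm (D * D)]
  ring

end GramMatrix

end Matrix

/-- The Gram matrix of an optimal set of `k` single-qubit probe states. -/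
noncomputable def optimalGram (k : ℝ) : Matrix (Fin 4) (Fin 4) ℝ :=
  diagonal fun j => if j = 0 then k / 2 else k / 6

section SingleQubit

variable {k : ℕ} {X : Matrix (Fin k) (Fin 4) ℝ}

theorem gram_zero_zero (hcol : ∀ r, X r 0 = 1 / √2) : (Xᵀ * X) 0 0 = k / 2 := by
  simp [mul_apply, hcol, ← mul_inv, div_eq_mul_inv]

theorem gram_trace_le (hrow : ∀ r, ∑ j, X r j ^ 2 ≤ 1) : (Xᵀ * X).trace ≤ k := by
  calc (Xᵀ * X).trace = ∑ r, ∑ j, X r j ^ 2 := by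
        simp only [trace, diag_apply, mul_apply, transpose_apply, ← sq]
        exact Finset.sum_comm
    _ ≤ ∑ _r : Fin k, (1 : ℝ) := Finset.sum_le_sum fun r _ => hrow r
    _ = k := by simp

theorem exists_gram_apply_self_le (hcol : ∀ r, X r 0 = 1 / √2)
    (hrow : ∀ r, ∑ j, X r j ^ 2 ≤ 1) : ∃ j, (Xᵀ * X) j j ≤ k / 6 := by
  have h0 := gram_zero_zero hcol
  have ht := gram_trace_le hrow
  rw [trace, Fin.sum_univ_four] at ht
  simp only [diag_apply] at ht
  by_contra! h
  linarith [h 1, h 2, h 3]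

theorem optimalGram_mul_inverse {x : ℝ} (hx : 0 < x) :
    optimalGram x * diagonal (fun j => if j = 0 then 2 / x else 6 / x) = 1 := by
  rw [optimalGram, diagonal_mul_diagonal, ← diagonal_one]
  congr 1
  ext j
  split_ifs <;> field_simp

theorem optimalGram_inv_trace {x : ℝ} (hx : 0 < x) : x * (optimalGram x)⁻¹.trace = 20 := by
  rw [inv_eq_right_inv (optimalGram_mul_inverse hx), trace_diagonal, Fin.sum_univ_four]
  simp
  field_simp
  norm_num

theorem residual_trace_le (hk : 0 < k) (hcol : ∀ r, X r 0 = 1 / √2)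
    (hrow : ∀ r, ∑ j, X r j ^ 2 ≤ 1) (hinv : IsUnit (Xᵀ * X)) {D : Matrix (Fin 4) (Fin 4) ℝ}
    (hD : D = diagonal fun j => if j = 0 then 2 / (k : ℝ) else 6 / k) :
    k * ((X * ((Xᵀ * X)⁻¹ - D))ᵀ * (X * ((Xᵀ * X)⁻¹ - D))).trace ≤
      k * (Xᵀ * X)⁻¹.trace - 20 := by
  have hk' : (0 : ℝ) < k := mod_cast hk
  rw [trace_transpose_mul_self_residual hinv (by rw [hD, diagonal_transpose])]
  have h0 := gram_zero_zero hcol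
  have ht := gram_trace_le hrow
  rw [trace, Fin.sum_univ_four] at ht
  simp only [diag_apply] at ht
  have hDt : D.trace = 20 / k := by
    rw [hD, trace_diagonal, Fin.sum_univ_four]
    simp
    ring
  have hDD : (Xᵀ * X * (D * D)).trace = (Xᵀ * X) 0 0 * (4 / k ^ 2) +
      ((Xᵀ * X) 1 1 + (Xᵀ * X) 2 2 + (Xᵀ * X) 3 3) * (36 / k ^ 2) := by
    rw [hD, diagonal_mul_diagonal, trace, Fin.sum_univ_four]
    simp only [diag_apply, mul_diagonal]
    simp
    ring
  have hle : (Xᵀ * X * (D * D)).trace ≤ 20 / k := by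
    rw [hDD]
    calc _ ≤ (k / 2 : ℝ) * (4 / k ^ 2) + (k / 2) * (36 / k ^ 2) := by
          gcongr
          · exact h0.le
          · linarith
      _ = 20 / k := by field_simp; norm_num
  rw [hDt]
  have := mul_le_mul_of_nonneg_left hle hk'.le
  have h20 : (k : ℝ) * (20 / k) = 20 := by field_simp
  linarith

theorem twenty_le_mul_gram_inv_trace (hk : 0 < k) (hcol : ∀ r, X r 0 = 1 / √2)
    (hrow : ∀ r, ∑ j, X r j ^ 2 ≤ 1) (hinv : IsUnit (Xᵀ * X)) :
    20 ≤ k * (Xᵀ * X)⁻¹.trace := by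
  have h := residual_trace_le hk hcol hrow hinv rfl
  have hnonneg := (posSemidef_conjTranspose_mul_self
    (X * ((Xᵀ * X)⁻¹ - diagonal fun j => if j = 0 then 2 / (k : ℝ) else 6 / k))).trace_nonneg
  rw [conjTranspose_eq_transpose_of_trivial] at hnonneg
  have hk' : (0 : ℝ) ≤ k := k.cast_nonneg
  linarith [mul_nonneg hk' hnonneg]

theorem gram_eq_optimalGram (hk : 0 < k) (hcol : ∀ r, X r 0 = 1 / √2)
    (hrow : ∀ r, ∑ j, X r j ^ 2 ≤ 1) (hinv : IsUnit (Xᵀ * X))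
    (heq : k * (Xᵀ * X)⁻¹.trace = 20) : Xᵀ * X = optimalGram k := by
  have hk' : (0 : ℝ) < k := mod_cast hk
  set D : Matrix (Fin 4) (Fin 4) ℝ := diagonal fun j => if j = 0 then 2 / (k : ℝ) else 6 / k
    with hD
  have h := residual_trace_le hk hcol hrow hinv hD
  have hnonneg := (posSemidef_conjTranspose_mul_self (X * ((Xᵀ * X)⁻¹ - D))).trace_nonneg
  have hzero : X * ((Xᵀ * X)⁻¹ - D) = 0 := by
    rw [← trace_conjTranspose_mul_self_eq_zero_iff]
    refine le_antisymm ?_ hnonneg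
    rw [conjTranspose_eq_transpose_of_trivial]
    refine nonpos_of_mul_nonpos_right ?_ hk'
    linarith
  have hGD : Xᵀ * X * D = 1 := by
    have := congr_arg (Xᵀ * ·) hzero
    simp only [← Matrix.mul_assoc, Matrix.mul_zero] at this
    rw [Matrix.mul_sub, mul_nonsing_inv _ ((isUnit_iff_isUnit_det _).mp hinv), sub_eq_zero] at this
    exact this.symm
  exact left_inv_eq_left_inv hGD (optimalGram_mul_inverse hk')

end SingleQubit

/-- Theorem 2 on m-qubit product probe states: if `X = X_1 ⊗ ⋯ ⊗ X_m` is the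
Kronecker product of single-qubit parameterization matrices (rows of norm ≤ 1,
first column constantly `1/√2`, invertible Gram matrices), then
`(∏ M_i) · Tr((XᵀX)⁻¹) ≥ 20^m` and `cond(X) ≥ 3^{m/2}`, with simultaneous
equality iff every `X_iᵀX_i = diag(M_i/2, M_i/6, M_i/6, M_i/6)`. -/
theorem stmt_8 (m : ℕ) (hm : 1 ≤ m) (M : Fin m → ℕ) (hM : ∀ i, 0 < M i)
    (Xs : ∀ i : Fin m, Matrix (Fin (M i)) (Fin 4) ℝ)
    (hrow : ∀ i r, ∑ j, (Xs i r j) ^ 2 ≤ 1)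
    (hcol : ∀ i r, Xs i r 0 = 1 / Real.sqrt 2)
    (hinv : ∀ i, IsUnit ((Xs i)ᵀ * Xs i))
    (X : Matrix (∀ i : Fin m, Fin (M i)) (∀ _ : Fin m, Fin 4) ℝ)
    (hX : ∀ f g, X f g = ∏ i, Xs i (f i) (g i))
    (hH : (Xᵀ * X).IsHermitian) :
    (20 : ℝ) ^ m ≤ (∏ i, (M i : ℝ)) * ((Xᵀ * X)⁻¹).trace ∧
    Real.sqrt 3 ^ m ≤
      Real.sqrt (⨆ e, hH.eigenvalues e) / Real.sqrt (⨅ e, hH.eigenvalues e) ∧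
    (((∏ i, (M i : ℝ)) * ((Xᵀ * X)⁻¹).trace = (20 : ℝ) ^ m ∧
        Real.sqrt (⨆ e, hH.eigenvalues e) / Real.sqrt (⨅ e, hH.eigenvalues e) =
          Real.sqrt 3 ^ m) ↔
      ∀ i, (Xs i)ᵀ * Xs i = Matrix.diagonal
        (fun j : Fin 4 => if j = 0 then (M i : ℝ) / 2 else (M i : ℝ) / 6)) := by
  have hM' (i) : (0 : ℝ) < M i := mod_cast hM i
  have hXk : X = piKronecker Xs := by
    ext f g
    rw [hX, piKronecker_apply]
  have hG : Xᵀ * X = piKronecker fun i => (Xs i)ᵀ * Xs i := by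
    rw [← piKronecker_mul, hXk]
    rfl
  have hGinv : Xᵀ * X * piKronecker (fun i => ((Xs i)ᵀ * Xs i)⁻¹) = 1 := by
    rw [hG, piKronecker_mul_piKronecker_inv hinv]
  have htr : (∏ i, (M i : ℝ)) * ((Xᵀ * X)⁻¹).trace =
      ∏ i, (M i : ℝ) * ((Xs i)ᵀ * Xs i)⁻¹.trace := by
    rw [inv_eq_right_inv hGinv, trace_piKronecker, Finset.prod_mul_distrib]
  have hfactor (i) := twenty_le_mul_gram_inv_trace (hM i) (hcol i) (hrow i) (hinv i)
  have h20 : (20 : ℝ) ^ m = ∏ _i : Fin m, (20 : ℝ) := by simp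
  have hpos := posDef_transpose_mul_self_of_isUnit (IsUnit.of_mul_eq_one _ hGinv)
  have hinf := hpos.iInf_eigenvalues_pos hH
  have hpow : (∏ i, (M i : ℝ) / 2) = 3 ^ m * ∏ i, (M i : ℝ) / 6 := by
    have : (3 : ℝ) ^ m = ∏ _i : Fin m, (3 : ℝ) := by simp
    rw [this, ← Finset.prod_mul_distrib]
    exact Finset.prod_congr rfl fun i _ => by ring
  have hsup : ∏ i, (M i : ℝ) / 2 ≤ ⨆ e, hH.eigenvalues e := by
    refine le_of_eq_of_le ?_ (hH.apply_self_le_iSup_eigenvalues fun _ => 0)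
    rw [hG, piKronecker_apply]
    exact Finset.prod_congr rfl fun i _ => (gram_zero_zero (hcol i)).symm
  have hinf_le : ⨅ e, hH.eigenvalues e ≤ ∏ i, (M i : ℝ) / 6 := by
    choose j hj using fun i => exists_gram_apply_self_le (hcol i) (hrow i)
    refine (hH.iInf_eigenvalues_le_apply_self j).trans ?_
    rw [hG, piKronecker_apply]
    exact Finset.prod_le_prod
      (fun i _ => (posDef_transpose_mul_self_of_isUnit (hinv i)).diag_pos.le) fun i _ => hj i
  have hsqrt : √3 ^ m = √(3 ^ m) := by
    rw [eq_comm, Real.sqrt_eq_iff_mul_self_eq (by positivity) (by positivity), ← mul_pow,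
      Real.mul_self_sqrt (by norm_num)]
  have hcond : √3 ^ m ≤ √(⨆ e, hH.eigenvalues e) / √(⨅ e, hH.eigenvalues e) := by
    rw [hsqrt, ← Real.sqrt_div' _ hinf.le]
    refine Real.sqrt_le_sqrt ?_
    rw [le_div_iff₀ hinf]
    calc _ ≤ 3 ^ m * ∏ i, (M i : ℝ) / 6 := by gcongr
      _ ≤ _ := hpow ▸ hsup
  refine ⟨?_, hcond, ?_, ?_⟩
  · rw [htr, h20]
    exact Finset.prod_le_prod (fun _ _ => by norm_num) fun i _ => hfactor i
  · rintro ⟨h, -⟩ i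
    refine gram_eq_optimalGram (hM i) (hcol i) (hrow i) (hinv i) ?_
    by_contra hne
    refine (Finset.prod_lt_prod (fun _ _ => by norm_num) (fun i _ => hfactor i)
      ⟨i, Finset.mem_univ i, (hfactor i).lt_of_ne' hne⟩).ne' ?_
    rw [← htr, ← h20, h]
  · intro hopt
    have htrace : (∏ i, (M i : ℝ)) * ((Xᵀ * X)⁻¹).trace = (20 : ℝ) ^ m := by
      rw [htr, h20]
      refine Finset.prod_congr rfl fun i _ => ?_
      rw [hopt i]
      exact optimalGram_inv_trace (hM' i)
    refine ⟨htrace, le_antisymm ?_ hcond⟩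
    simp_rw [hopt, piKronecker_diagonal] at hG
    have hbounds (e) : ∏ i, (M i : ℝ) / 6 ≤ hH.eigenvalues e ∧
        hH.eigenvalues e ≤ ∏ i, (M i : ℝ) / 2 := by
      obtain ⟨g, hg⟩ := exists_eigenvalues_eq_of_eq_diagonal hH hG e
      rw [← hg]
      constructor <;> refine Finset.prod_le_prod (fun i _ => ?_) fun i _ => ?_ <;>
        have := hM' i <;> (try split_ifs) <;> linarith
    rw [hsqrt, ← Real.sqrt_div' _ hinf.le]
    refine Real.sqrt_le_sqrt ?_
    rw [div_le_iff₀ hinf]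
    calc _ ≤ ∏ i, (M i : ℝ) / 2 := ciSup_le fun e => (hbounds e).2
      _ = 3 ^ m * ∏ i, (M i : ℝ) / 6 := hpow
      _ ≤ _ := by
        gcongr
        exact le_ciInf fun e => (hbounds e).1
end

section
/- Let M > 0 be a real number and let λ_1 ≥ λ_2 ≥ ⋯ ≥ λ_16 > 0 be real numbers satisfying Σ_{i=1}^{16} λ_i = M, λ_1 ≥ M/4, λ_1 + λ_2 + λ_3 + λ_4 ≥ M/2, and Σ_{i=1}^{7} λ_i ≥ 3M/4. Then Σ_{i=1}^{16} M/λ_i ≥ 400, with equality if and only if λ_1 = M/4, λ_2 = ⋯ = λ_7 = M/12, and λ_8 = ⋯ = λ_16 = M/36. Moreover, under these constraints λ_1/λ_16 ≥ 9, so √(λ_1/λ_16) ≥ 3. -/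
/-- The reciprocals `M / μ` of the optimal eigenvalues `μ`, for total mass `M`. -/
def optimalWeight (i : Fin 16) : ℝ :=
  if (i : ℕ) = 0 then 4 else if (i : ℕ) < 7 then 12 else 36

theorem div_eq_tangent_add_sq {M x : ℝ} (hM : M ≠ 0) (hx : x ≠ 0) (c : ℝ) :
    M / x = 2 * c - c ^ 2 * x / M + (c * x - M) ^ 2 / (x * M) := by
  field_simp
  ring

/-- The sum of the tangent lines is at least `400`, so the squared remainders bound the excess. -/
theorem add_sum_sq_le_sum_div {M : ℝ} (hM : 0 < M) {lam : Fin 16 → ℝ}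
    (hpos : ∀ i, 0 < lam i) (hsum : ∑ i, lam i = M) (h1 : M / 4 ≤ lam 0)
    (h7 : 3 * M / 4 ≤ ∑ i ∈ Finset.univ.filter (fun i : Fin 16 => (i : ℕ) < 7), lam i) :
    400 + ∑ i, (optimalWeight i * lam i - M) ^ 2 / (lam i * M) ≤ ∑ i, M / lam i := by
  have hsplit : ∑ i, M / lam i = ∑ i, 2 * optimalWeight i
      - (∑ i, optimalWeight i ^ 2 * lam i) / M
      + ∑ i, (optimalWeight i * lam i - M) ^ 2 / (lam i * M) := by
    rw [Finset.sum_div, ← Finset.sum_sub_distrib, ← Finset.sum_add_distrib]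
    exact Finset.sum_congr rfl fun i _ =>
      div_eq_tangent_add_sq hM.ne' (hpos i).ne' (optimalWeight i)
  have hconst : ∑ i, 2 * optimalWeight i = 800 := by
    simp [optimalWeight, Fin.sum_univ_succ]
    norm_num
  have hlin : (∑ i, optimalWeight i ^ 2 * lam i) / M ≤ 400 := by
    rw [div_le_iff₀ hM]
    rw [Finset.sum_filter] at h7
    simp [optimalWeight, Fin.sum_univ_succ] at hsum h7 ⊢
    linarith
  rw [hsplit, hconst]
  linarith

/-- The constrained optimization of Section 3.4 for two-qubit product probe
states: if `λ_1 ≥ ⋯ ≥ λ_16 > 0`, `Σ λ_i = M`, `λ_1 ≥ M/4`,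
`λ_1 + λ_2 + λ_3 + λ_4 ≥ M/2` and `Σ_{i=1}^7 λ_i ≥ 3M/4`, then
`Σ M/λ_i ≥ 400` with the stated equality case, and `λ_1/λ_16 ≥ 9`, so
`√(λ_1/λ_16) ≥ 3`. -/
theorem stmt_10 (M : ℝ) (hM : 0 < M) (lam : Fin 16 → ℝ)
    (hmono : Antitone lam) (hpos : ∀ i, 0 < lam i)
    (hsum : ∑ i, lam i = M)
    (h1 : M / 4 ≤ lam 0)
    (h4 : M / 2 ≤ ∑ i ∈ Finset.univ.filter (fun i : Fin 16 => (i : ℕ) < 4), lam i)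
    (h7 : 3 * M / 4 ≤ ∑ i ∈ Finset.univ.filter (fun i : Fin 16 => (i : ℕ) < 7), lam i) :
    (400 : ℝ) ≤ ∑ i, M / lam i ∧
    (∑ i, M / lam i = 400 ↔ ∀ i : Fin 16,
      lam i = if (i : ℕ) = 0 then M / 4 else if (i : ℕ) < 7 then M / 12 else M / 36) ∧
    9 ≤ lam 0 / lam 15 ∧ 3 ≤ Real.sqrt (lam 0 / lam 15) := by
  have hkey := add_sum_sq_le_sum_div hM hpos hsum h1 h7
  have hterm : ∀ i ∈ Finset.univ, 0 ≤ (optimalWeight i * lam i - M) ^ 2 / (lam i * M) :=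
    fun i _ => div_nonneg (sq_nonneg _) (mul_pos (hpos i) hM).le
  have hrem := Finset.sum_nonneg hterm
  have hratio : 9 ≤ lam 0 / lam 15 := by
    rw [le_div_iff₀ (hpos 15)]
    have hlast : ∀ i, lam 15 ≤ lam i := fun i => hmono (Fin.le_last i)
    have htail : 9 * lam 15 ≤ ∑ i ∈ Finset.univ.filter (fun i : Fin 16 => ¬ (i : ℕ) < 7), lam i := by
      have h := Finset.card_nsmul_le_sum
        (Finset.univ.filter (fun i : Fin 16 => ¬ (i : ℕ) < 7)) lam (lam 15) fun i _ => hlast i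
      rw [show (Finset.univ.filter (fun i : Fin 16 => ¬ (i : ℕ) < 7)).card = 9 by decide] at h
      simpa using h
    have hsplit := Finset.sum_filter_add_sum_filter_not Finset.univ
      (fun i : Fin 16 => (i : ℕ) < 7) lam
    linarith
  refine ⟨by linarith, ⟨fun heq i => ?_, fun h => ?_⟩, hratio, ?_⟩
  · have hzero := (Finset.sum_eq_zero_iff_of_nonneg hterm).1 (by linarith) i (Finset.mem_univ i)
    have hi : optimalWeight i * lam i - M = 0 := by
      simpa [(hpos i).ne', hM.ne'] using hzero
    unfold optimalWeight at hi
    split_ifs at hi ⊢ <;> linarith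
  · have hquot : ∀ i, M / lam i = optimalWeight i := by
      intro i
      rw [h i]
      unfold optimalWeight
      split_ifs <;> field_simp
    simp only [hquot]
    simp [optimalWeight, Fin.sum_univ_succ]
    norm_num
  · exact Real.le_sqrt_of_sq_le (by linarith)
end

section
/- Let d, M be positive integers, ε > 0, and let X and X̂ be real M × d² matrices such that every row of X and every row of X̂ has Euclidean norm at most 1, and every row of X − X̂ has Euclidean norm at most ε. Let λ_{d²} > 0 be the smallest eigenvalue of XᵀX and suppose 2Mε < λ_{d²}. Then X̂ᵀX̂ is invertible and |Tr((XᵀX)⁻¹) − Tr((X̂ᵀX̂)⁻¹)| ≤ 2d²Mε/(λ_{d²} − 2Mε)²; consequently, multiplying by (n−1)M/(4N), the error in the UMSE is at most 2(n−1)d²M²ε/(4N(λ_{d²} − 2Mε)²). -/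
open Matrix

section Auxiliary

variable {m n : Type*} [Fintype m] [Fintype n]

lemma dotProduct_self_nonneg (u : n → ℝ) : 0 ≤ u ⬝ᵥ u :=
  Finset.sum_nonneg fun i _ => mul_self_nonneg (u i)

lemma abs_dotProduct_le_sqrt_mul_sqrt (u v : n → ℝ) :
    |u ⬝ᵥ v| ≤ √(u ⬝ᵥ u) * √(v ⬝ᵥ v) := by
  rw [← Real.sqrt_mul (dotProduct_self_nonneg u)]
  refine Real.abs_le_sqrt ?_
  simpa only [dotProduct, pow_two] using Finset.sum_mul_sq_le_sq_mul_sq Finset.univ u v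

/-- The quadratic form of a real symmetric matrix is bounded below by any lower bound of its
eigenvalues. -/
lemma Matrix.IsHermitian.mul_dotProduct_self_le [DecidableEq n] {A : Matrix n n ℝ}
    (hA : A.IsHermitian) {c : ℝ} (hc : ∀ i, c ≤ hA.eigenvalues i) (v : n → ℝ) :
    c * (v ⬝ᵥ v) ≤ v ⬝ᵥ A *ᵥ v := by
  open scoped MatrixOrder in
  have hle : algebraMap ℝ (Matrix n n ℝ) c ≤ A := by
    refine algebraMap_le_of_le_spectrum (fun x hx => ?_) hA.isSelfAdjoint
    rw [hA.spectrum_real_eq_range_eigenvalues] at hx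
    obtain ⟨i, rfl⟩ := hx
    exact hc i
  have h := (Matrix.le_iff.mp hle).dotProduct_mulVec_nonneg v
  simpa [sub_mulVec, Algebra.algebraMap_eq_smul_one, smul_mulVec] using h

lemma Matrix.isUnit_of_coercive [DecidableEq n] {A : Matrix n n ℝ} {c : ℝ} (hc : 0 < c)
    (hA : ∀ v, c * (v ⬝ᵥ v) ≤ v ⬝ᵥ A *ᵥ v) : IsUnit A := by
  rw [← mulVec_injective_iff_isUnit]
  refine (injective_iff_map_eq_zero A.mulVecLin).mpr fun v hv => ?_
  have h := hA v
  rw [show A *ᵥ v = 0 from hv, dotProduct_zero] at h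
  exact dotProduct_self_eq_zero.mp
    (le_antisymm (nonpos_of_mul_nonpos_right h hc) (dotProduct_self_nonneg v))

lemma Matrix.sqrt_inv_mulVec_le_of_coercive [DecidableEq n] {A : Matrix n n ℝ} {c : ℝ}
    (hc : 0 < c) (hA : ∀ v, c * (v ⬝ᵥ v) ≤ v ⬝ᵥ A *ᵥ v) (u : n → ℝ) :
    √((A⁻¹ *ᵥ u) ⬝ᵥ (A⁻¹ *ᵥ u)) ≤ √(u ⬝ᵥ u) / c := by
  have hdet := (isUnit_iff_isUnit_det A).mp (isUnit_of_coercive hc hA)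
  set w := A⁻¹ *ᵥ u with hw
  have hAw : A *ᵥ w = u := by rw [hw, mulVec_mulVec, mul_nonsing_inv A hdet, one_mulVec]
  have h := (hA w).trans ((le_abs_self _).trans (abs_dotProduct_le_sqrt_mul_sqrt _ _))
  rw [hAw] at h
  rw [le_div_iff₀ hc]
  rcases (Real.sqrt_nonneg (w ⬝ᵥ w)).eq_or_lt with h0 | h0
  · rw [← h0, zero_mul]
    exact Real.sqrt_nonneg _
  · refine le_of_mul_le_mul_left ?_ h0
    calc √(w ⬝ᵥ w) * (√(w ⬝ᵥ w) * c) = c * (√(w ⬝ᵥ w) * √(w ⬝ᵥ w)) := by ring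
      _ ≤ _ := by rwa [Real.mul_self_sqrt (dotProduct_self_nonneg w)]

/-- Perturbing the rows of `X` by at most `ε` perturbs the bilinear form of the Gram matrix
`Xᵀ * X` by at most `2 * card m * ε`. -/
lemma Matrix.abs_dotProduct_gram_sub_gram_le {X Y : Matrix m n ℝ} {ε : ℝ} (hε : 0 ≤ ε)
    (hX : ∀ i, √(X i ⬝ᵥ X i) ≤ 1) (hY : ∀ i, √(Y i ⬝ᵥ Y i) ≤ 1)
    (hXY : ∀ i, √((X i - Y i) ⬝ᵥ (X i - Y i)) ≤ ε) (u v : n → ℝ) :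
    |u ⬝ᵥ (Yᵀ * Y - Xᵀ * X) *ᵥ v| ≤
      2 * Fintype.card m * ε * (√(u ⬝ᵥ u) * √(v ⬝ᵥ v)) := by
  have hgram (Z : Matrix m n ℝ) :
      u ⬝ᵥ (Zᵀ * Z) *ᵥ v = ∑ i, (Z i ⬝ᵥ u) * (Z i ⬝ᵥ v) := by
    rw [← mulVec_mulVec, dotProduct_mulVec, vecMul_transpose]
    rfl
  have hrow {r : n → ℝ} {c : ℝ} (hr : √(r ⬝ᵥ r) ≤ c) (w : n → ℝ) :
      |r ⬝ᵥ w| ≤ c * √(w ⬝ᵥ w) :=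
    (abs_dotProduct_le_sqrt_mul_sqrt r w).trans
      (mul_le_mul_of_nonneg_right hr (Real.sqrt_nonneg _))
  have hterm (i : m) : |(Y i ⬝ᵥ u) * (Y i ⬝ᵥ v) - (X i ⬝ᵥ u) * (X i ⬝ᵥ v)| ≤
      2 * ε * (√(u ⬝ᵥ u) * √(v ⬝ᵥ v)) := by
    have hsplit : (Y i ⬝ᵥ u) * (Y i ⬝ᵥ v) - (X i ⬝ᵥ u) * (X i ⬝ᵥ v) =
        -(((X i - Y i) ⬝ᵥ u) * (X i ⬝ᵥ v) + (Y i ⬝ᵥ u) * ((X i - Y i) ⬝ᵥ v)) := by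
      simp only [sub_dotProduct]
      ring
    rw [hsplit, abs_neg]
    refine (abs_add_le _ _).trans ?_
    rw [abs_mul, abs_mul]
    calc _ ≤ ε * √(u ⬝ᵥ u) * (1 * √(v ⬝ᵥ v)) + 1 * √(u ⬝ᵥ u) * (ε * √(v ⬝ᵥ v)) := by
          gcongr
          exacts [hrow (hXY i) u, hrow (hX i) v, hrow (hY i) u, hrow (hXY i) v]
      _ = _ := by ring
  rw [sub_mulVec, dotProduct_sub, hgram, hgram, ← Finset.sum_sub_distrib]
  refine (Finset.abs_sum_le_sum_abs _ _).trans ((Finset.sum_le_sum fun i _ => hterm i).trans ?_)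
  rw [Finset.sum_const, nsmul_eq_mul, Finset.card_univ]
  exact le_of_eq (by ring)

/-- Traces of inverses of coercive symmetric matrices are Lipschitz in the operator norm. -/
lemma Matrix.abs_trace_inv_sub_trace_inv_le [DecidableEq n] {A B : Matrix n n ℝ} {a b δ : ℝ}
    (hsymm : A.IsSymm) (ha : 0 < a) (hb : 0 < b) (hδ : 0 ≤ δ)
    (hA : ∀ v, a * (v ⬝ᵥ v) ≤ v ⬝ᵥ A *ᵥ v) (hB : ∀ v, b * (v ⬝ᵥ v) ≤ v ⬝ᵥ B *ᵥ v)
    (hAB : ∀ u v, |u ⬝ᵥ (B - A) *ᵥ v| ≤ δ * (√(u ⬝ᵥ u) * √(v ⬝ᵥ v))) :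
    |A⁻¹.trace - B⁻¹.trace| ≤ Fintype.card n * (δ / (a * b)) := by
  have hAu := (isUnit_iff_isUnit_det A).mp (isUnit_of_coercive ha hA)
  have hBu := (isUnit_iff_isUnit_det B).mp (isUnit_of_coercive hb hB)
  have hinv : A⁻¹ - B⁻¹ = A⁻¹ * (B - A) * B⁻¹ := by
    rw [mul_sub, sub_mul, nonsing_inv_mul A hAu, mul_assoc, mul_nonsing_inv B hBu, mul_one,
      one_mul]
  have hdiag (k : n) : |(A⁻¹ - B⁻¹) k k| ≤ δ / (a * b) := by
    set e : n → ℝ := Pi.single k 1 with he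
    have hentry : (A⁻¹ - B⁻¹) k k = (A⁻¹ *ᵥ e) ⬝ᵥ (B - A) *ᵥ (B⁻¹ *ᵥ e) := by
      rw [← vecMul_transpose, transpose_nonsing_inv, hsymm.eq, ← dotProduct_mulVec,
        mulVec_mulVec, mulVec_mulVec, ← hinv, he]
      simp
    have hnorm : √(e ⬝ᵥ e) = 1 := by simp [he]
    have h1 := sqrt_inv_mulVec_le_of_coercive ha hA e
    have h2 := sqrt_inv_mulVec_le_of_coercive hb hB e
    rw [hnorm] at h1 h2
    rw [hentry]
    calc _ ≤ _ := hAB _ _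
      _ ≤ δ * (1 / a * (1 / b)) := by gcongr
      _ = δ / (a * b) := by field_simp
  rw [← trace_sub, trace]
  refine (Finset.abs_sum_le_sum_abs _ _).trans ((Finset.sum_le_sum fun k _ => hdiag k).trans ?_)
  rw [Finset.sum_const, nsmul_eq_mul, Finset.card_univ]

end Auxiliary

/-- UMSE part of Theorem 3 (robustness against state-preparation errors):
if the rows of `X` and `X̂` have norm at most 1, every row of `X − X̂` has norm
at most `ε`, and `2Mε` is smaller than the smallest eigenvalue `λ` of `XᵀX`,
then `X̂ᵀX̂` is invertible,
`|Tr((XᵀX)⁻¹) − Tr((X̂ᵀX̂)⁻¹)| ≤ 2d²Mε/(λ − 2Mε)²`, and the corresponding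
error in the UMSE is at most `2(n−1)d²M²ε/(4N(λ − 2Mε)²)`. -/
theorem stmt_11 (d M : ℕ) (hd : 0 < d) (hM : 0 < M) (ε : ℝ) (hε : 0 < ε)
    (X Y : Matrix (Fin M) (Fin (d ^ 2)) ℝ)
    (hrowX : ∀ i : Fin M, ∑ j, (X i j) ^ 2 ≤ 1)
    (hrowY : ∀ i : Fin M, ∑ j, (Y i j) ^ 2 ≤ 1)
    (hdiff : ∀ i : Fin M, ∑ j, (X i j - Y i j) ^ 2 ≤ ε ^ 2)
    (hH : (Xᵀ * X).IsHermitian) (lam : ℝ)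
    (hlam : lam = ⨅ i, hH.eigenvalues i) (hlam_pos : 0 < lam)
    (hball : 2 * M * ε < lam) :
    IsUnit (Yᵀ * Y) ∧
    |((Xᵀ * X)⁻¹).trace - ((Yᵀ * Y)⁻¹).trace| ≤
      2 * (d : ℝ) ^ 2 * M * ε / (lam - 2 * M * ε) ^ 2 ∧
    ∀ n N : ℝ, 1 ≤ n → 0 < N →
      (n - 1) * M / (4 * N) * |((Xᵀ * X)⁻¹).trace - ((Yᵀ * Y)⁻¹).trace| ≤
        2 * (n - 1) * (d : ℝ) ^ 2 * (M : ℝ) ^ 2 * ε /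
          (4 * N * (lam - 2 * M * ε) ^ 2) := by
  have hsqrt {r : Fin (d ^ 2) → ℝ} {c : ℝ} (hc : 0 ≤ c) (hr : ∑ j, r j ^ 2 ≤ c ^ 2) :
      √(r ⬝ᵥ r) ≤ c :=
    Real.sqrt_le_iff.mpr ⟨hc, by simpa only [dotProduct, pow_two] using hr⟩
  have hpert := abs_dotProduct_gram_sub_gram_le hε.le
    (fun i => hsqrt zero_le_one (by simpa using hrowX i))
    (fun i => hsqrt zero_le_one (by simpa using hrowY i)) (fun i => hsqrt hε.le (hdiff i))
  rw [Fintype.card_fin] at hpert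
  have hA := hH.mul_dotProduct_self_le (c := lam)
    fun i => hlam ▸ ciInf_le (Set.finite_range _).bddBelow i
  have hgap : 0 < lam - 2 * M * ε := sub_pos.mpr hball
  have hB (v : Fin (d ^ 2) → ℝ) :
      (lam - 2 * M * ε) * (v ⬝ᵥ v) ≤ v ⬝ᵥ (Yᵀ * Y) *ᵥ v := by
    have h := (abs_le.mp (hpert v v)).1
    rw [Real.mul_self_sqrt (dotProduct_self_nonneg v), sub_mulVec, dotProduct_sub] at h
    linarith [hA v]
  have hδ : 0 ≤ 2 * M * ε := by positivity
  have htrace : |((Xᵀ * X)⁻¹).trace - ((Yᵀ * Y)⁻¹).trace| ≤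
      2 * (d : ℝ) ^ 2 * M * ε / (lam - 2 * M * ε) ^ 2 := by
    have hsymm : (Xᵀ * X).IsSymm := by simp [IsSymm, transpose_mul]
    refine (abs_trace_inv_sub_trace_inv_le hsymm hlam_pos hgap hδ hA hB hpert).trans ?_
    rw [Fintype.card_fin, Nat.cast_pow]
    calc (d : ℝ) ^ 2 * (2 * M * ε / (lam * (lam - 2 * M * ε)))
        ≤ (d : ℝ) ^ 2 * (2 * M * ε / ((lam - 2 * M * ε) * (lam - 2 * M * ε))) := by
          gcongr
          linarith
      _ = _ := by ring
  refine ⟨isUnit_of_coercive hgap hB, htrace, fun n N hn hN => ?_⟩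
  have hcoef : 0 ≤ (n - 1) * M / (4 * N) :=
    div_nonneg (mul_nonneg (sub_nonneg.mpr hn) M.cast_nonneg) (by positivity)
  refine (mul_le_mul_of_nonneg_left htrace hcoef).trans_eq ?_
  rw [div_mul_div_comm]
  ring
end

section
/- Let d, M be positive integers, ε > 0, and let X and X̂ be real M × d² matrices such that every row of X and every row of X̂ has Euclidean norm at most 1, and every row of X − X̂ has Euclidean norm at most ε. Let λ_1 and λ_{d²} > 0 denote the largest and smallest eigenvalues of XᵀX, and suppose 2Mε < λ_{d²}. Then |cond(X) − cond(X̂)| ≤ M(λ_1 + λ_{d²})ε/(λ_{d²} − 2Mε)², where cond(Y) = √(λ_max(YᵀY)/λ_min(YᵀY)) is the condition number. -/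
open Matrix

section QuadraticForm

variable {n : Type*} [Fintype n] [DecidableEq n] {A B : Matrix n n ℝ}

/-- A real symmetric quadratic form is diagonal in the coordinates given by an eigenbasis. -/
lemma Matrix.IsHermitian.exists_dotProduct_eq_sum_eigenvalues (hA : A.IsHermitian) (x : n → ℝ) :
    ∃ w : n → ℝ, x ⬝ᵥ A *ᵥ x = ∑ i, hA.eigenvalues i * w i ^ 2 ∧ x ⬝ᵥ x = ∑ i, w i ^ 2 := by
  set U : Matrix n n ℝ := (hA.eigenvectorUnitary : Matrix n n ℝ) with hU
  have hUU : U * Uᵀ = 1 := by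
    simpa [star_eq_conjTranspose] using Unitary.coe_mul_star_self hA.eigenvectorUnitary
  have hspec : A = U * diagonal hA.eigenvalues * Uᵀ := by
    conv_lhs => rw [hA.spectral_theorem, Unitary.conjStarAlgAut_apply]
    simp [hU, star_eq_conjTranspose]
  have key : ∀ D : Matrix n n ℝ, x ⬝ᵥ (U * D * Uᵀ) *ᵥ x = (Uᵀ *ᵥ x) ⬝ᵥ D *ᵥ (Uᵀ *ᵥ x) := by
    intro D
    rw [← mulVec_mulVec, ← mulVec_mulVec, dotProduct_mulVec, mulVec_transpose]
  refine ⟨Uᵀ *ᵥ x, ?_, ?_⟩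
  · conv_lhs => rw [hspec]
    rw [key]
    simp only [dotProduct, mulVec_diagonal]
    exact Finset.sum_congr rfl fun i _ => by ring
  · have h := key 1
    rw [mul_one, hUU, one_mulVec, one_mulVec] at h
    rw [h]
    simp only [dotProduct]
    exact Finset.sum_congr rfl fun i _ => by ring

lemma Matrix.IsHermitian.exists_unit_dotProduct_eq_eigenvalue (hA : A.IsHermitian) (i : n) :
    ∃ x : n → ℝ, x ⬝ᵥ x = 1 ∧ x ⬝ᵥ A *ᵥ x = hA.eigenvalues i := by
  have h1 : (hA.eigenvectorBasis i : n → ℝ) ⬝ᵥ (hA.eigenvectorBasis i : n → ℝ) = 1 := by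
    have := congrFun (congrFun (Unitary.coe_star_mul_self hA.eigenvectorUnitary) i) i
    simpa [Matrix.mul_apply, dotProduct] using this
  refine ⟨hA.eigenvectorBasis i, h1, ?_⟩
  rw [hA.mulVec_eigenvectorBasis, dotProduct_smul, h1, smul_eq_mul, mul_one]

lemma Matrix.IsHermitian.dotProduct_mulVec_le_iSup (hA : A.IsHermitian) (x : n → ℝ) :
    x ⬝ᵥ A *ᵥ x ≤ (⨆ i, hA.eigenvalues i) * (x ⬝ᵥ x) := by
  obtain ⟨w, h1, h2⟩ := hA.exists_dotProduct_eq_sum_eigenvalues x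
  rw [h1, h2, Finset.mul_sum]
  gcongr with i
  exact le_ciSup (Set.finite_range _).bddAbove i

lemma Matrix.IsHermitian.iInf_le_dotProduct_mulVec (hA : A.IsHermitian) (x : n → ℝ) :
    (⨅ i, hA.eigenvalues i) * (x ⬝ᵥ x) ≤ x ⬝ᵥ A *ᵥ x := by
  obtain ⟨w, h1, h2⟩ := hA.exists_dotProduct_eq_sum_eigenvalues x
  rw [h1, h2, Finset.mul_sum]
  gcongr with i
  exact ciInf_le (Set.finite_range _).bddBelow i

lemma Matrix.IsHermitian.iSup_eigenvalues_le_add [Nonempty n] (hA : A.IsHermitian)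
    (hB : B.IsHermitian) {η : ℝ}
    (h : ∀ x : n → ℝ, x ⬝ᵥ A *ᵥ x ≤ x ⬝ᵥ B *ᵥ x + η * (x ⬝ᵥ x)) :
    ⨆ i, hA.eigenvalues i ≤ (⨆ i, hB.eigenvalues i) + η := by
  refine ciSup_le fun i => ?_
  obtain ⟨x, hx, hi⟩ := hA.exists_unit_dotProduct_eq_eigenvalue i
  have h1 := h x
  have h2 := hB.dotProduct_mulVec_le_iSup x
  rw [hx] at h1 h2
  linarith

lemma Matrix.IsHermitian.iInf_eigenvalues_le_add [Nonempty n] (hA : A.IsHermitian)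
    (hB : B.IsHermitian) {η : ℝ}
    (h : ∀ x : n → ℝ, x ⬝ᵥ A *ᵥ x ≤ x ⬝ᵥ B *ᵥ x + η * (x ⬝ᵥ x)) :
    ⨅ i, hA.eigenvalues i ≤ (⨅ i, hB.eigenvalues i) + η := by
  rw [← sub_le_iff_le_add]
  refine le_ciInf fun i => ?_
  obtain ⟨x, hx, hi⟩ := hB.exists_unit_dotProduct_eq_eigenvalue i
  have h1 := h x
  have h2 := hA.iInf_le_dotProduct_mulVec x
  rw [hx] at h1 h2
  linarith

end QuadraticForm

lemma abs_dotProduct_le_mul_sqrt {n : Type*} [Fintype n] {u : n → ℝ} {c : ℝ} (hc : 0 ≤ c)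
    (hu : ∑ j, u j ^ 2 ≤ c ^ 2) (x : n → ℝ) : |u ⬝ᵥ x| ≤ c * √(x ⬝ᵥ x) := by
  have hx : x ⬝ᵥ x = ∑ j, x j ^ 2 := Finset.sum_congr rfl fun i _ => by ring
  have hx0 : 0 ≤ ∑ j, x j ^ 2 := Finset.sum_nonneg fun i _ => sq_nonneg _
  refine abs_le_of_sq_le_sq ?_ (by positivity)
  rw [mul_pow, hx, Real.sq_sqrt hx0]
  exact (Finset.sum_mul_sq_le_sq_mul_sq _ _ _).trans (by gcongr)

/-- Perturbing each of the `M` rows of a matrix with rows in the unit ball by at most `ε` changes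
the quadratic form of its Gram matrix by at most `2 * M * ε`. -/
lemma dotProduct_transpose_mul_self_le {m n : Type*} [Fintype m] [Fintype n]
    {X Y : Matrix m n ℝ} {ε : ℝ} (hε : 0 ≤ ε)
    (hX : ∀ i, ∑ j, X i j ^ 2 ≤ 1) (hY : ∀ i, ∑ j, Y i j ^ 2 ≤ 1)
    (hXY : ∀ i, ∑ j, (X i j - Y i j) ^ 2 ≤ ε ^ 2) (x : n → ℝ) :
    x ⬝ᵥ (Xᵀ * X) *ᵥ x ≤ x ⬝ᵥ (Yᵀ * Y) *ᵥ x + 2 * Fintype.card m * ε * (x ⬝ᵥ x) := by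
  have gram : ∀ Z : Matrix m n ℝ, x ⬝ᵥ (Zᵀ * Z) *ᵥ x = ∑ i, (Z i ⬝ᵥ x) ^ 2 := by
    intro Z
    rw [← mulVec_mulVec, dotProduct_mulVec, vecMul_transpose]
    exact Finset.sum_congr rfl fun i _ => by rw [sq]; rfl
  have hx0 : 0 ≤ x ⬝ᵥ x := Finset.sum_nonneg fun i _ => mul_self_nonneg _
  have hrow : ∀ i, (X i ⬝ᵥ x) ^ 2 ≤ (Y i ⬝ᵥ x) ^ 2 + 2 * ε * (x ⬝ᵥ x) := by
    intro i
    have h1 := abs_dotProduct_le_mul_sqrt zero_le_one (by simpa using hX i) x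
    have h2 := abs_dotProduct_le_mul_sqrt zero_le_one (by simpa using hY i) x
    have h3 := abs_dotProduct_le_mul_sqrt (u := X i - Y i) hε (by simpa using hXY i) x
    have h4 : |X i ⬝ᵥ x + Y i ⬝ᵥ x| ≤ 2 * √(x ⬝ᵥ x) := by
      linarith [abs_add_le (X i ⬝ᵥ x) (Y i ⬝ᵥ x)]
    have h5 := mul_le_mul h3 h4 (abs_nonneg _) (by positivity)
    rw [← abs_mul, sub_dotProduct] at h5
    nlinarith [le_abs_self ((X i ⬝ᵥ x - Y i ⬝ᵥ x) * (X i ⬝ᵥ x + Y i ⬝ᵥ x)), Real.sq_sqrt hx0]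
  rw [gram, gram]
  calc ∑ i, (X i ⬝ᵥ x) ^ 2 ≤ ∑ i, ((Y i ⬝ᵥ x) ^ 2 + 2 * ε * (x ⬝ᵥ x)) :=
        Finset.sum_le_sum fun i _ => hrow i
    _ = _ := by
        rw [Finset.sum_add_distrib, Finset.sum_const, Finset.card_univ, nsmul_eq_mul]
        ring

lemma abs_sqrt_sub_sqrt_le_half {a b : ℝ} (ha : 1 ≤ a) (hb : 1 ≤ b) :
    |√a - √b| ≤ |a - b| / 2 := by
  have h1 : 1 ≤ √a := Real.one_le_sqrt.mpr ha
  have h2 : 1 ≤ √b := Real.one_le_sqrt.mpr hb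
  have h : a - b = (√a - √b) * (√a + √b) := by
    linear_combination -(Real.sq_sqrt (zero_le_one.trans ha)) + Real.sq_sqrt (zero_le_one.trans hb)
  rw [h, abs_mul, abs_of_pos (by linarith : 0 < √a + √b)]
  nlinarith [abs_nonneg (√a - √b)]

lemma abs_div_sub_div_le {a b a' b' η : ℝ} (ha : 0 ≤ a) (hη : η < b) (hη0 : 0 ≤ η)
    (h1 : |a - a'| ≤ η) (h2 : |b - b'| ≤ η) :
    |a / b - a' / b'| ≤ η * (a + b) / (b - η) ^ 2 := by
  have hb : 0 < b := hη0.trans_lt hη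
  have hb' : b - η ≤ b' := by linarith [(abs_le.mp h2).2]
  have hpos : 0 < b - η := sub_pos.mpr hη
  have hb'0 : 0 < b' := hpos.trans_le hb'
  have hnum : |a * b' - b * a'| ≤ η * (a + b) := by
    have : a * b' - b * a' = b * (a - a') - a * (b - b') := by ring
    rw [this]
    refine (abs_sub _ _).trans ?_
    rw [abs_mul, abs_mul, abs_of_pos hb, abs_of_nonneg ha]
    nlinarith
  rw [div_sub_div _ _ hb.ne' hb'0.ne', abs_div, abs_of_pos (mul_pos hb hb'0)]
  have hden : (b - η) ^ 2 ≤ b * b' := by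
    rw [sq]
    exact mul_le_mul (by linarith) hb' hpos.le hb.le
  exact div_le_div₀ (by positivity) hnum (by positivity) hden

/-- Condition-number part of Theorem 3 (robustness against state-preparation
errors): if the rows of `X` and `X̂` have norm at most 1, every row of `X − X̂`
has norm at most `ε`, and `2Mε < λ_{d²}` where `λ_1` and `λ_{d²}` are the
largest and smallest eigenvalues of `XᵀX`, then
`|cond(X) − cond(X̂)| ≤ M(λ_1 + λ_{d²})ε/(λ_{d²} − 2Mε)²`, where
`cond(Y) = √(λ_max(YᵀY)/λ_min(YᵀY))`. -/
theorem stmt_12 (d M : ℕ) (hd : 0 < d) (hM : 0 < M) (ε : ℝ) (hε : 0 < ε)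
    (X Y : Matrix (Fin M) (Fin (d ^ 2)) ℝ)
    (hrowX : ∀ i : Fin M, ∑ j, (X i j) ^ 2 ≤ 1)
    (hrowY : ∀ i : Fin M, ∑ j, (Y i j) ^ 2 ≤ 1)
    (hdiff : ∀ i : Fin M, ∑ j, (X i j - Y i j) ^ 2 ≤ ε ^ 2)
    (hH : (Xᵀ * X).IsHermitian) (hHY : (Yᵀ * Y).IsHermitian)
    (lam1 lamd : ℝ)
    (hlam1 : lam1 = ⨆ i, hH.eigenvalues i)
    (hlamd : lamd = ⨅ i, hH.eigenvalues i) (hlamd_pos : 0 < lamd)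
    (hball : 2 * M * ε < lamd) :
    |Real.sqrt ((⨆ i, hH.eigenvalues i) / (⨅ i, hH.eigenvalues i)) -
      Real.sqrt ((⨆ i, hHY.eigenvalues i) / (⨅ i, hHY.eigenvalues i))| ≤
      M * (lam1 + lamd) * ε / (lamd - 2 * M * ε) ^ 2 := by
  have : Nonempty (Fin (d ^ 2)) := ⟨⟨0, by positivity⟩⟩
  have hXY := dotProduct_transpose_mul_self_le hε.le hrowX hrowY hdiff
  have hYX := dotProduct_transpose_mul_self_le hε.le hrowY hrowX fun i => by
    simpa only [sub_sq_comm] using hdiff i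
  rw [Fintype.card_fin] at hXY hYX
  have s1 := hH.iSup_eigenvalues_le_add hHY hXY
  have s2 := hHY.iSup_eigenvalues_le_add hH hYX
  have i1 := hH.iInf_eigenvalues_le_add hHY hXY
  have i2 := hHY.iInf_eigenvalues_le_add hH hYX
  have l1 : ⨅ i, hH.eigenvalues i ≤ ⨆ i, hH.eigenvalues i :=
    ciInf_le_ciSup (Set.finite_range _).bddBelow (Set.finite_range _).bddAbove
  have l2 : ⨅ i, hHY.eigenvalues i ≤ ⨆ i, hHY.eigenvalues i :=
    ciInf_le_ciSup (Set.finite_range _).bddBelow (Set.finite_range _).bddAbove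
  rw [← hlam1] at s1 s2 l1 ⊢
  rw [← hlamd] at i1 i2 l1 ⊢
  have hη : 0 ≤ 2 * (M : ℝ) * ε := by positivity
  have hpos : 0 < ⨅ i, hHY.eigenvalues i := by linarith
  have hdiv := abs_div_sub_div_le (hlamd_pos.le.trans l1) hball hη
    (abs_le.mpr ⟨by linarith, by linarith⟩ : |lam1 - ⨆ i, hHY.eigenvalues i| ≤ _)
    (abs_le.mpr ⟨by linarith, by linarith⟩ : |lamd - ⨅ i, hHY.eigenvalues i| ≤ _)
  calc _ ≤ _ := abs_sqrt_sub_sqrt_le_half ((one_le_div hlamd_pos).mpr l1)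
        ((one_le_div hpos).mpr l2)
    _ ≤ _ := div_le_div_of_nonneg_right hdiv zero_le_two
    _ = _ := by ring
end
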